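/- The subgroup W_l is normal in W, W_l ∩ W(Π_s) = {1}, and W = W(Π_s)·W_l; in other words, W is the internal semidirect product of W(Π_s) acting on the normal subgroup W_l. -/

import Mathlib

open scoped RealInnerProductSpace

/-- The orthogonal reflection of a Euclidean space in the hyperplane orthogonal to `α`
(for `α ≠ 0` this is the usual reflection `x ↦ x - 2(x|α)/(α|α) α`). -/
noncomputable def rrefl {E : Type} [NormedAddCommGroup E] [InnerProductSpace ℝ E]
    [FiniteDimensional ℝ E] (α : E) : E ≃ₗᵢ[ℝ] E :=
  Submodule.reflection ((ℝ ∙ α)ᗮ)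

/-- The group generated by the reflections `r_α` for `α ∈ S`. -/
noncomputable def weylOf {E : Type} [NormedAddCommGroup E] [InnerProductSpace ℝ E]
    [FiniteDimensional ℝ E] (S : Set E) : Subgroup (E ≃ₗᵢ[ℝ] E) :=
  Subgroup.closure (rrefl '' S)

section aux
variable {E : Type} [NormedAddCommGroup E] [InnerProductSpace ℝ E] [FiniteDimensional ℝ E]

lemma rrefl_apply' (α x : E) :
    rrefl α x = x - (2 * ⟪x, α⟫ / ⟪α, α⟫) • α := by
  unfold rrefl
  rw [Submodule.reflection_orthogonal_apply, Submodule.reflection_singleton_apply,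
    real_inner_comm, real_inner_self_eq_norm_sq]
  simp only [RCLike.ofReal_real_eq_id, id]
  rw [neg_sub, ← Nat.cast_smul_eq_nsmul ℝ, smul_smul]
  congr 2
  push_cast
  ring

lemma rrefl_conj (w : E ≃ₗᵢ[ℝ] E) (α : E) : rrefl (w α) = w * rrefl α * w⁻¹ := by
  ext x
  obtain ⟨y, rfl⟩ := w.surjective x
  have h : (w * rrefl α * w⁻¹) (w y) = w (rrefl α y) := by
    change w (rrefl α (w.symm (w y))) = _
    simp
  rw [h, rrefl_apply', rrefl_apply', map_sub, map_smul]
  simp [LinearIsometryEquiv.inner_map_map]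

lemma rrefl_neg (α : E) : rrefl (-α) = rrefl α := by
  ext x; simp [rrefl_apply', neg_div, sub_eq_add_neg]

lemma rrefl_mul_self (α : E) : rrefl α * rrefl α = 1 := by
  ext x
  change rrefl α (rrefl α x) = x
  unfold rrefl; simp

lemma rrefl_inv (α : E) : (rrefl α)⁻¹ = rrefl α :=
  inv_eq_of_mul_eq_one_left (rrefl_mul_self α)

lemma rrefl_self (α : E) (h : α ≠ 0) : rrefl α α = -α := by
  rw [rrefl_apply', mul_div_assoc, div_self (by simpa using h)]
  rw [mul_one, two_smul]; abel

/-- long-simple roots -/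
def simp' (Ψ : Set E) (f : E →ₗ[ℝ] ℝ) : Set E :=
  {γ | γ ∈ Ψ ∧ 0 < f γ ∧ ∀ δ ∈ Ψ, 0 < f δ → δ ≠ γ → 0 < f (rrefl γ δ)}

/-- induction on height over a finite set -/
lemma height_ind (Ψ : Set E) (hfin : Ψ.Finite) (f : E →ₗ[ℝ] ℝ) (P : E → Prop)
    (h : ∀ γ ∈ Ψ, (∀ δ ∈ Ψ, f δ < f γ → P δ) → P γ) : ∀ γ ∈ Ψ, P γ := by
  by_contra! hc
  obtain ⟨γ0, h0, h1⟩ := hc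
  have hf : ({γ ∈ Ψ | ¬ P γ}).Finite := hfin.subset (fun x hx => hx.1)
  obtain ⟨m, hm, hmin⟩ := Set.exists_min_image _ f hf ⟨γ0, h0, h1⟩
  refine hm.2 (h m hm.1 fun δ hδ hlt => ?_)
  by_contra hP
  exact absurd (hmin δ ⟨hδ, hP⟩) (not_le.mpr hlt)

lemma gen_simple (Ψ : Set E) (hfin : Ψ.Finite) (L : ℝ) (hL : 0 < L) (hn : ∀ γ ∈ Ψ, ‖γ‖ = L)
    (hrefl : ∀ α ∈ Ψ, ∀ β ∈ Ψ, rrefl α β ∈ Ψ)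
    (hcrys : ∀ α ∈ Ψ, ∀ β ∈ Ψ, ∃ n : ℤ, 2 * ⟪β, α⟫ / ⟪α, α⟫ = (n : ℝ))
    (f : E →ₗ[ℝ] ℝ) (hf : ∀ γ ∈ Ψ, f γ ≠ 0) :
    ∀ γ ∈ Ψ, 0 < f γ → rrefl γ ∈ weylOf (simp' Ψ f) := by
  apply height_ind Ψ hfin f
  intro γ hγ ih hpos
  by_cases hs : γ ∈ simp' Ψ f
  · exact Subgroup.subset_closure ⟨γ, hs, rfl⟩
  · have : ∃ δ ∈ Ψ, 0 < f δ ∧ δ ≠ γ ∧ f (rrefl γ δ) ≤ 0 := by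
      by_contra! hc
      exact hs ⟨hγ, hpos, hc⟩
    obtain ⟨δ, hδ, hδp, hne, hle⟩ := this
    have hlt : f (rrefl γ δ) < 0 := lt_of_le_of_ne hle (hf _ (hrefl γ hγ δ hδ))
    obtain ⟨n, hn'⟩ := hcrys γ hγ δ hδ
    have hr : rrefl γ δ = δ - (n : ℝ) • γ := by rw [rrefl_apply', hn']
    rw [hr, map_sub, map_smul, smul_eq_mul] at hlt
    have hnpos : (0 : ℝ) < n := by
      by_contra hc
      push Not at hc
      nlinarith
    have hγγ : ⟪γ, γ⟫ = L ^ 2 := by rw [real_inner_self_eq_norm_sq, hn γ hγ]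
    have hδδ : ⟪δ, δ⟫ = L ^ 2 := by rw [real_inner_self_eq_norm_sq, hn δ hδ]
    have hsub : 0 < ⟪δ - γ, δ - γ⟫ := by
      rw [real_inner_self_eq_norm_sq]
      have : 0 < ‖δ - γ‖ := norm_pos_iff.mpr (sub_ne_zero.mpr hne)
      positivity
    rw [real_inner_sub_sub_self, hγγ, hδδ] at hsub
    have hL2 : 0 < L ^ 2 := by positivity
    rw [hγγ, div_eq_iff hL2.ne'] at hn'
    have hn2 : (n : ℝ) < 2 := by
      by_contra hc
      push Not at hc
      nlinarith
    have hn1 : n = 1 := by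
      have h1 : 0 < n := by exact_mod_cast hnpos
      have h2 : n < 2 := by exact_mod_cast hn2
      omega
    subst hn1
    have hd : rrefl δ γ = γ - δ := by
      rw [rrefl_apply', hδδ, real_inner_comm, hn']
      rw [mul_div_assoc, div_self hL2.ne']; simp
    have hdm := hrefl δ hδ γ hγ
    have hg : γ = rrefl δ (rrefl δ γ) := by
      have := congrArg (fun g : E ≃ₗᵢ[ℝ] E => g γ) (rrefl_mul_self δ)
      exact this.symm
    push_cast at hlt
    have k1 := ih δ hδ (by linarith) hδp
    have k2 := ih _ hdm (by rw [hd, map_sub]; linarith) (by rw [hd, map_sub]; linarith)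
    rw [hg, rrefl_conj, rrefl_inv]
    exact mul_mem (mul_mem k1 k2) k1

lemma exchange (Ψ : Set E) (h0 : (0 : E) ∉ Ψ)
    (hrefl : ∀ α ∈ Ψ, ∀ β ∈ Ψ, rrefl α β ∈ Ψ)
    (f : E →ₗ[ℝ] ℝ) (hf : ∀ γ ∈ Ψ, f γ ≠ 0) (γ : E) (hγ : γ ∈ simp' Ψ f) :
    ∀ l : List E, (∀ x ∈ l, x ∈ simp' Ψ f) → f ((l.map rrefl).prod γ) < 0 →
      ∃ l' : List E, (∀ x ∈ l', x ∈ simp' Ψ f) ∧ l'.length < l.length ∧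
        (l.map rrefl).prod * rrefl γ = (l'.map rrefl).prod := by
  intro l
  induction l with
  | nil =>
    intro _ h
    simp at h
    exact absurd hγ.2.1 (not_lt.mpr h.le)
  | cons s t ih =>
    intro hl hneg
    have hs := hl s (by simp)
    have ht : ∀ x ∈ t, x ∈ simp' Ψ f := fun x hx => hl x (by simp [hx])
    have hmem : ∀ u : List E, (∀ x ∈ u, x ∈ simp' Ψ f) → (u.map rrefl).prod γ ∈ Ψ := by
      intro u
      induction u with
      | nil => intro _; simpa using hγ.1
      | cons a b ihb =>
        intro hu
        rw [List.map_cons, List.prod_cons]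
        exact hrefl a (hu a (by simp)).1 _ (ihb fun x hx => hu x (by simp [hx]))
    by_cases hlt : f ((t.map rrefl).prod γ) < 0
    · obtain ⟨l', h1, h2, h3⟩ := ih ht hlt
      refine ⟨s :: l', ?_, by simpa using h2, ?_⟩
      · intro x hx
        rcases List.mem_cons.mp hx with rfl | hx
        · exact hs
        · exact h1 x hx
      · simp only [List.map_cons, List.prod_cons]
        rw [mul_assoc, h3]
    · have hpos : 0 < f ((t.map rrefl).prod γ) :=
        lt_of_le_of_ne (not_lt.mp hlt) (hf _ (hmem t ht)).symm
      have heq : (t.map rrefl).prod γ = s := by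
        by_contra hne
        have := hs.2.2 _ (hmem t ht) hpos hne
        rw [List.map_cons, List.prod_cons] at hneg
        exact absurd hneg (not_lt.mpr this.le)
      refine ⟨t, ht, by simp, ?_⟩
      have hc := rrefl_conj (t.map rrefl).prod γ
      rw [heq] at hc
      rw [List.map_cons, List.prod_cons]
      have : (t.map rrefl).prod * rrefl γ = rrefl s * (t.map rrefl).prod := by
        rw [hc]; group
      rw [mul_assoc, this, ← mul_assoc, rrefl_mul_self, one_mul]

lemma list_of_mem (S : Set E) (w : E ≃ₗᵢ[ℝ] E) (hw : w ∈ weylOf S) :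
    ∃ l : List E, (∀ x ∈ l, x ∈ S) ∧ w = (l.map rrefl).prod := by
  unfold weylOf at hw
  induction hw using Subgroup.closure_induction with
  | mem x hx => obtain ⟨a, ha, rfl⟩ := hx; exact ⟨[a], by simpa using ha, by simp⟩
  | one => exact ⟨[], by simp, by simp⟩
  | mul x y _ _ hx hy =>
    obtain ⟨l, h1, rfl⟩ := hx
    obtain ⟨m, h2, rfl⟩ := hy
    refine ⟨l ++ m, ?_, by simp⟩
    intro x hx
    rcases List.mem_append.mp hx with h | h
    · exact h1 x h
    · exact h2 x h
  | inv x _ hx =>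
    obtain ⟨l, h1, rfl⟩ := hx
    refine ⟨l.reverse, by simpa using h1, ?_⟩
    rw [List.prod_inv_reverse, List.map_reverse, List.map_map]
    have : (fun x => x⁻¹) ∘ (rrefl : E → _) = rrefl := funext rrefl_inv
    rw [this]

lemma triv_of_pos (Ψ : Set E) (h0 : (0 : E) ∉ Ψ)
    (hrefl : ∀ α ∈ Ψ, ∀ β ∈ Ψ, rrefl α β ∈ Ψ)
    (f : E →ₗ[ℝ] ℝ) (hf : ∀ γ ∈ Ψ, f γ ≠ 0) (w : E ≃ₗᵢ[ℝ] E)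
    (hw : ∀ γ ∈ Ψ, 0 < f γ → 0 < f (w γ)) :
    ∀ (n : ℕ) (l : List E), l.length = n → (∀ x ∈ l, x ∈ simp' Ψ f) →
      w = (l.map rrefl).prod → w = 1 := by
  intro n
  induction n using Nat.strong_induction_on with
  | _ n ih =>
    intro l hlen hl hwl
    rcases List.eq_nil_or_concat l with rfl | ⟨t, γ, rfl⟩
    · simpa using hwl
    · have hγ := hl γ (by simp)
      have ht : ∀ x ∈ t, x ∈ simp' Ψ f := fun x hx => hl x (by simp [hx])
      have hwl' : w = (t.map rrefl).prod * rrefl γ := by simpa using hwl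
      have hp := hw γ hγ.1 hγ.2.1
      have hγ0 : γ ≠ 0 := fun h => h0 (h ▸ hγ.1)
      rw [hwl'] at hp
      change 0 < f ((t.map rrefl).prod (rrefl γ γ)) at hp
      rw [rrefl_self γ hγ0, map_neg, map_neg] at hp
      obtain ⟨l', h1, h2, h3⟩ := exchange Ψ h0 hrefl f hf γ hγ t ht (by linarith)
      simp at hlen
      exact ih l'.length (by omega) l' rfl h1 (hwl'.trans h3)

end aux

/-- `W_l` (generated by the reflections in the long roots) is normal in `W`,
`W_l ∩ W(Πs) = {1}`, and `W = W(Πs)·W_l`: `W` is the internal semidirect product of `W(Πs)`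
acting on the normal subgroup `W_l`. -/
theorem statement1
    {E : Type} [NormedAddCommGroup E] [InnerProductSpace ℝ E] [FiniteDimensional ℝ E]
    (Δ Δs Δl Δp Φ Φs : Set E)
    -- `Δ` is a finite set of nonzero vectors spanning `E`
    (hfin : Δ.Finite) (h0 : (0 : E) ∉ Δ)
    (hspan : Submodule.span ℝ Δ = ⊤)
    -- stable under all root reflections
    (hrefl : ∀ α ∈ Δ, ∀ β ∈ Δ, rrefl α β ∈ Δ)
    -- crystallographic
    (hcrys : ∀ α ∈ Δ, ∀ β ∈ Δ, ∃ n : ℤ, 2 * ⟪β, α⟫ / ⟪α, α⟫ = (n : ℝ))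
    -- reduced
    (hred : ∀ α ∈ Δ, ∀ t : ℝ, t • α ∈ Δ → t = 1 ∨ t = -1)
    -- irreducible
    (hirr : ∀ A B : Set E, A ∪ B = Δ → (∀ a ∈ A, ∀ b ∈ B, ⟪a, b⟫ = 0) → A = ∅ ∨ B = ∅)
    -- two root lengths: `Δs` are the short roots, `Δl` the long ones
    (ls ll : ℝ) (h0ls : 0 < ls) (hlsll : ls < ll)
    (hΔs : Δs = {α ∈ Δ | ‖α‖ = ls}) (hΔl : Δl = {α ∈ Δ | ‖α‖ = ll})
    (hcover : Δ = Δs ∪ Δl) (hsne : Δs.Nonempty) (hlne : Δl.Nonempty)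
    -- `Δp` is a positive system: for each root exactly one of `±α` is positive
    (hΔpΔ : Δp ⊆ Δ) (hpm : ∀ α ∈ Δ, α ∈ Δp ↔ -α ∉ Δp)
    -- `Φ` is the corresponding set of simple roots, `Φs = Φ ∩ Δs` the short simple roots
    (hΦp : Φ ⊆ Δp)
    (hΦind : LinearIndependent ℝ (fun a : Φ => (a : E)))
    (hΦdec : ∀ γ ∈ Δp, ∃ c : E →₀ ℕ, ↑c.support ⊆ Φ ∧ γ = c.sum fun α n => (n : ℝ) • α)
    (hΦs : Φs = Φ ∩ Δs)
 :
    (∀ w ∈ weylOf Δ, ∀ x ∈ weylOf Δl, w * x * w⁻¹ ∈ weylOf Δl) ∧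
    weylOf Δl ⊓ weylOf Φs = ⊥ ∧
    (∀ w ∈ weylOf Δ, ∃ a ∈ weylOf Φs, ∃ b ∈ weylOf Δl, w = a * b) := by
  classical
  have hne : ∀ α ∈ Δ, α ≠ 0 := fun α hα h => h0 (h ▸ hα)
  have hneg : ∀ α ∈ Δ, -α ∈ Δ := fun α hα => by
    rw [← rrefl_self α (hne α hα)]; exact hrefl α hα α hα
  have hrl : ∀ α ∈ Δ, ∀ β ∈ Δl, rrefl α β ∈ Δl := by
    intro α hα β hβ
    rw [hΔl] at hβ ⊢
    exact ⟨hrefl α hα β hβ.1, by rw [LinearIsometryEquiv.norm_map]; exact hβ.2⟩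
  have hlΔ : Δl ⊆ Δ := by rw [hΔl]; exact fun x hx => hx.1
  -- functionals
  have hfun : ∀ v : E → ℝ, ∃ g : E →ₗ[ℝ] ℝ, ∀ α ∈ Φ, g α = v α := by
    intro v
    have hli : LinearIndepOn ℝ id Φ := hΦind
    let b := Module.Basis.extend hli
    let g := b.constr ℝ (fun i => v i)
    refine ⟨g, fun α hα => ?_⟩
    have hm := hli.subset_extend (Set.subset_univ _) hα
    have h2 : b ⟨α, hm⟩ = α := by
      simp [b]
    have h3 := b.constr_basis ℝ (fun i => v i) ⟨α, hm⟩
    rw [h2] at h3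
    exact h3
  have hdec : ∀ γ ∈ Δp, ∃ c : E →₀ ℕ, ↑c.support ⊆ Φ ∧
      (γ = c.sum fun α n => (n : ℝ) • α) ∧ ∀ (v : E → ℝ) (g : E →ₗ[ℝ] ℝ),
      (∀ α ∈ Φ, g α = v α) → g γ = c.sum fun α n => (n : ℝ) * v α := by
    intro γ hγ
    obtain ⟨c, hc, hs⟩ := hΦdec γ hγ
    refine ⟨c, hc, hs, fun v g hg => ?_⟩
    rw [hs, Finsupp.sum, map_sum, Finsupp.sum]
    refine Finset.sum_congr rfl fun α hα => ?_
    rw [map_smul, smul_eq_mul, hg α (hc hα)]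
  have hnn : ∀ (g : E →ₗ[ℝ] ℝ), (∀ α ∈ Φ, 0 ≤ g α) → ∀ γ ∈ Δp, 0 ≤ g γ := by
    intro g hg γ hγ
    obtain ⟨c, hc, hs, h⟩ := hdec γ hγ
    rw [h g g (fun _ _ => rfl)]
    exact Finset.sum_nonneg fun α hα => mul_nonneg (Nat.cast_nonneg _) (hg α (hc hα))
  obtain ⟨f, hf1⟩ := hfun (fun _ => 1)
  have hfpos : ∀ γ ∈ Δp, 0 < f γ := by
    intro γ hγ
    obtain ⟨c, hc, hs, h⟩ := hdec γ hγ
    rw [h _ f hf1]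
    refine Finset.sum_pos (fun α hα => ?_) ?_
    · simp only [mul_one]
      exact_mod_cast Nat.pos_of_ne_zero (Finsupp.mem_support_iff.mp hα)
    · rw [Finset.nonempty_iff_ne_empty]
      intro he
      apply hne γ (hΔpΔ hγ)
      rw [hs, Finsupp.sum, he, Finset.sum_empty]
  have hor : ∀ γ ∈ Δ, γ ∉ Δp → -γ ∈ Δp := by
    intro γ hγ h
    by_contra hc
    exact h ((hpm γ hγ).mpr hc)
  have hpiff : ∀ γ ∈ Δ, 0 < f γ → γ ∈ Δp := by
    intro γ hγ hp
    by_contra hc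
    have := hfpos _ (hor γ hγ hc)
    rw [map_neg] at this
    linarith
  have hfne : ∀ γ ∈ Δ, f γ ≠ 0 := by
    intro γ hγ h
    by_cases hp : γ ∈ Δp
    · exact (hfpos γ hp).ne' h
    · have := hfpos _ (hor γ hγ hp)
      rw [map_neg, h] at this
      simp at this
  -- simple reflections
  have hsimple : ∀ α ∈ Φ, ∀ γ ∈ Δp, γ ≠ α → rrefl α γ ∈ Δp := by
    intro α hα γ hγ hγα
    have hαΔ := hΔpΔ (hΦp hα)
    obtain ⟨c, hc, hs, h⟩ := hdec γ hγ
    by_cases hb : ∃ β ∈ c.support, β ≠ α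
    · obtain ⟨β, hβ, hβα⟩ := hb
      obtain ⟨g, hg⟩ := hfun (fun x => if x = β then 1 else 0)
      have hgn := hnn g (fun x hx => by rw [hg x hx]; split_ifs <;> norm_num)
      have hgγ : 0 < g γ := by
        rw [h _ g hg, Finsupp.sum]
        refine Finset.sum_pos' (fun x _ => by positivity) ⟨β, hβ, ?_⟩
        simp only [if_true, mul_one]
        exact_mod_cast Nat.pos_of_ne_zero (Finsupp.mem_support_iff.mp hβ)
      have hgα : g α = 0 := by rw [hg α hα]; simp [hβα.symm]
      have hgr : g (rrefl α γ) = g γ := by rw [rrefl_apply', map_sub, map_smul, hgα]; simp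
      by_contra hc
      have := hgn _ (hor _ (hrefl α hαΔ γ (hΔpΔ hγ)) hc)
      rw [map_neg, hgr] at this
      linarith
    · push Not at hb
      exfalso
      have hsub : c.support ⊆ {α} := fun x hx => by simpa using hb x hx
      have h1 : γ = (c α : ℝ) • α := by
        rw [hs]
        exact Finsupp.sum_of_support_subset _ hsub _ (by simp) |>.trans (by simp)
      have h2 := hred α hαΔ (c α) (h1 ▸ hΔpΔ hγ)
      rcases h2 with h2 | h2
      · rw [h2, one_smul] at h1; exact hγα h1
      · have : (0:ℝ) ≤ c α := Nat.cast_nonneg _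
        linarith
  have hnorm : ∀ w ∈ weylOf Δ, ∀ γ ∈ Δl, w γ ∈ Δl := by
    intro w hw
    obtain ⟨l, hl, rfl⟩ := list_of_mem _ _ hw
    clear hw
    intro γ hγ
    induction l with
    | nil => simpa using hγ
    | cons a t ih =>
      rw [List.map_cons, List.prod_cons]
      exact hrl a (hl a (by simp)) _ (ih fun x hx => hl x (by simp [hx]))
  have hN : ∀ w ∈ weylOf Δ, ∀ x ∈ weylOf Δl, w * x * w⁻¹ ∈ weylOf Δl := by
    intro w hw x hx
    unfold weylOf at hx
    induction hx using Subgroup.closure_induction with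
    | mem x hx =>
      obtain ⟨a, ha, rfl⟩ := hx
      rw [← rrefl_conj]
      exact Subgroup.subset_closure ⟨_, hnorm w hw a ha, rfl⟩
    | one => simp
    | mul x y _ _ hx hy =>
      have : w * (x * y) * w⁻¹ = (w * x * w⁻¹) * (w * y * w⁻¹) := by group
      rw [this]; exact mul_mem hx hy
    | inv x _ hx =>
      have : w * x⁻¹ * w⁻¹ = (w * x * w⁻¹)⁻¹ := by group
      rw [this]; exact inv_mem hx
  have hΦsΔ : Φs ⊆ Δ := fun x hx => by
    rw [hΦs] at hx; exact hΔpΔ (hΦp hx.1)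
  have hWs : weylOf Φs ≤ weylOf Δ := Subgroup.closure_mono (Set.image_mono hΦsΔ)
  refine ⟨hN, ?_, ?_⟩
  · rw [eq_bot_iff]
    rintro w ⟨hwl, hws⟩
    rw [Subgroup.mem_bot]
    have hΨfin : Δl.Finite := hfin.subset hlΔ
    have hgs := gen_simple Δl hΨfin ll (h0ls.trans hlsll) (by rw [hΔl]; exact fun x hx => hx.2)
      (fun α hα => hrl α (hlΔ hα)) (fun α hα β hβ => hcrys α (hlΔ hα) β (hlΔ hβ)) f
      (fun γ hγ => hfne γ (hlΔ hγ))
    have hle : weylOf Δl ≤ weylOf (simp' Δl f) := by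
      unfold weylOf
      rw [Subgroup.closure_le]
      rintro _ ⟨γ, hγ, rfl⟩
      rcases lt_or_gt_of_ne (hfne γ (hlΔ hγ)) with h | h
      · rw [← rrefl_neg]
        refine hgs _ ?_ (by rw [map_neg]; linarith)
        rw [hΔl] at hγ ⊢
        exact ⟨hneg _ hγ.1, by rw [norm_neg]; exact hγ.2⟩
      · exact hgs γ hγ h
    obtain ⟨l, hl, hwl'⟩ := list_of_mem _ _ (hle hwl)
    refine triv_of_pos Δl (fun h => h0 (hlΔ h)) (fun α hα => hrl α (hlΔ hα)) f
      (fun γ hγ => hfne γ (hlΔ hγ)) w ?_ _ l rfl hl hwl'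
    obtain ⟨m, hm, rfl⟩ := list_of_mem _ _ hws
    clear hwl hws hwl'
    have : ∀ γ ∈ Δl, 0 < f γ → (m.map rrefl).prod γ ∈ Δl ∧ 0 < f ((m.map rrefl).prod γ) := by
      intro γ hγ hp
      induction m with
      | nil => simpa using ⟨hγ, hp⟩
      | cons a t ih =>
        obtain ⟨k1, k2⟩ := ih fun x hx => hm x (by simp [hx])
        have ha := hm a (by simp)
        rw [List.map_cons, List.prod_cons]
        refine ⟨hrl a (hΦsΔ ha) _ k1, ?_⟩
        refine hfpos _ (hsimple a ?_ _ (hpiff _ (hlΔ k1) k2) ?_)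
        · rw [hΦs] at ha; exact ha.1
        · intro he
          have he' : (t.map rrefl).prod γ = a := he
          rw [he', hΔl] at k1
          rw [hΦs, hΔs] at ha
          have e1 := k1.2
          have e2 := ha.2.2
          linarith
    exact fun γ hγ hp => (this γ hγ hp).2
  · -- every element factors
    have hfac : ∀ w ∈ weylOf Φ, ∃ a ∈ weylOf Φs, ∃ b ∈ weylOf Δl, w = a * b := by
      intro w hw
      obtain ⟨l, hl, rfl⟩ := list_of_mem _ _ hw
      clear hw
      induction l with
      | nil => exact ⟨1, one_mem _, 1, one_mem _, by simp⟩
      | cons s t ih =>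
        obtain ⟨a, ha, b, hb, hab⟩ := ih fun x hx => hl x (by simp [hx])
        have hs := hl s (by simp)
        have hsΔ := hΔpΔ (hΦp hs)
        rw [List.map_cons, List.prod_cons, hab]
        have hsΔ' := hsΔ
        rw [hcover] at hsΔ'
        rcases hsΔ' with h | h
        · refine ⟨rrefl s * a, mul_mem (Subgroup.subset_closure ⟨s, ?_, rfl⟩) ha, b, hb,
            by rw [mul_assoc]⟩
          rw [hΦs]; exact ⟨hs, h⟩
        · refine ⟨a, ha, (a⁻¹ * rrefl s * a) * b, mul_mem ?_ hb, by group⟩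
          have := hN a⁻¹ (inv_mem (hWs ha)) (rrefl s) (Subgroup.subset_closure ⟨s, h, rfl⟩)
          simpa using this
    have hgen : ∀ γ ∈ Δ, γ ∈ Δp → rrefl γ ∈ weylOf Φ := by
      apply height_ind Δ hfin f
      intro γ hγ ih hp
      by_cases hγΦ : γ ∈ Φ
      · exact Subgroup.subset_closure ⟨γ, hγΦ, rfl⟩
      · have hex : ∃ α ∈ Φ, 0 < ⟪γ, α⟫ := by
          by_contra! hc
          have h1 := hnn (-(innerSL ℝ γ).toLinearMap) (fun α hα => by
            have := hc α hα
            simpa using this) γ hp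
          have h2 : ⟪γ, γ⟫ ≤ 0 := by simpa using h1
          exact absurd (real_inner_self_pos.mpr (hne γ hγ)) (not_lt.mpr h2)
        obtain ⟨α, hα, hpos⟩ := hex
        have hαΔ := hΔpΔ (hΦp hα)
        have hr := hsimple α hα γ hp (fun h => hγΦ (h ▸ hα))
        have hα2 : 0 < ⟪α, α⟫ := real_inner_self_pos.mpr (hne α hαΔ)
        have hlt : f (rrefl α γ) < f γ := by
          rw [rrefl_apply', map_sub, map_smul, smul_eq_mul]
          have h1 := hfpos α (hΦp hα)
          have : 0 < 2 * ⟪γ, α⟫ / ⟪α, α⟫ * f α := by positivity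
          linarith
        have k := ih _ (hΔpΔ hr) hlt hr
        have ka : rrefl α ∈ weylOf Φ := Subgroup.subset_closure ⟨α, hα, rfl⟩
        have hg : γ = rrefl α (rrefl α γ) := by
          have := congrArg (fun g : E ≃ₗᵢ[ℝ] E => g γ) (rrefl_mul_self α)
          exact this.symm
        rw [hg, rrefl_conj, rrefl_inv]
        exact mul_mem (mul_mem ka k) ka
    have hle : weylOf Δ ≤ weylOf Φ := by
      conv_lhs => unfold weylOf
      rw [Subgroup.closure_le]
      rintro _ ⟨γ, hγ, rfl⟩
      by_cases hp : γ ∈ Δp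
      · exact hgen γ hγ hp
      · rw [← rrefl_neg]
        exact hgen _ (hneg γ hγ) (hor γ hγ hp)
    exact fun w hw => hfac w (hle hw)
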